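/- Let C and Ĉ = C + Δ be n×n Hermitian complex matrices. Let u_j be a unit eigenvector of C with eigenvalue λ_j, and let û_i be a unit eigenvector of Ĉ with eigenvalue λ̂_i. Then |λ̂_i − λ_j| · |⟨û_i, u_j⟩| ≤ ‖Δ u_j‖₂. -/

import Mathlib

open Matrix Finset

/-- For Hermitian `C` and `Ĉ = C + Δ`, a unit eigenvector `u_j` of `C`
with eigenvalue `λ_j` and a unit eigenvector `û_i` of `Ĉ` with eigenvalue `λ̂_i`,
`|λ̂_i - λ_j| * |⟨û_i, u_j⟩| ≤ ‖Δ u_j‖₂`. -/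
theorem eigvec_angle_perturbation_bound {n : ℕ}
    (C Δ Chat : Matrix (Fin n) (Fin n) ℂ)
    (hC : C.IsHermitian) (hChat : Chat.IsHermitian) (hsum : Chat = C + Δ)
    (uj uhati : Fin n → ℂ) (lamj lamhati : ℝ)
    (huj : star uj ⬝ᵥ uj = 1) (hCuj : C.mulVec uj = (lamj : ℂ) • uj)
    (huhati : star uhati ⬝ᵥ uhati = 1)
    (hCuhati : Chat.mulVec uhati = (lamhati : ℂ) • uhati) :
    |lamhati - lamj| * ‖star uhati ⬝ᵥ uj‖
      ≤ Real.sqrt (∑ a, ‖Δ.mulVec uj a‖ ^ 2) := by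
  have h1 : star uhati ᵥ* Chat = (lamhati : ℂ) • star uhati := by
    have h := congrArg star hCuhati
    rw [Matrix.star_mulVec, hChat.eq] at h
    rw [h, star_smul]
    simp
  have h2 : Δ *ᵥ uj = Chat *ᵥ uj - (lamj : ℂ) • uj := by
    rw [hsum, Matrix.add_mulVec, hCuj]
    simp
  have h3 : star uhati ⬝ᵥ (Δ *ᵥ uj) = ((lamhati - lamj : ℝ) : ℂ) * (star uhati ⬝ᵥ uj) := by
    rw [h2, dotProduct_sub, Matrix.dotProduct_mulVec, h1, smul_dotProduct, dotProduct_smul]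
    simp only [smul_eq_mul]
    push_cast
    ring
  have h4 : ∑ a, ‖uhati a‖ ^ 2 = 1 := by
    have h : ((∑ a, ‖uhati a‖ ^ 2 : ℝ) : ℂ) = 1 := by
      rw [← huhati]
      push_cast
      refine Finset.sum_congr rfl fun a _ => ?_
      exact (Complex.conj_mul' (uhati a)).symm
    exact_mod_cast h
  have h5 : |lamhati - lamj| * ‖star uhati ⬝ᵥ uj‖ = ‖star uhati ⬝ᵥ (Δ *ᵥ uj)‖ := by
    rw [h3, norm_mul, Complex.norm_real, Real.norm_eq_abs]
  rw [h5]
  calc ‖star uhati ⬝ᵥ (Δ *ᵥ uj)‖ ≤ ∑ a, ‖uhati a‖ * ‖(Δ *ᵥ uj) a‖ := by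
        refine (norm_sum_le _ _).trans (le_of_eq ?_)
        refine Finset.sum_congr rfl fun a _ => ?_
        rw [norm_mul, Pi.star_apply, norm_star]
    _ ≤ Real.sqrt (∑ a, ‖uhati a‖ ^ 2) * Real.sqrt (∑ a, ‖(Δ *ᵥ uj) a‖ ^ 2) :=
        Real.sum_mul_le_sqrt_mul_sqrt _ _ _
    _ = Real.sqrt (∑ a, ‖(Δ *ᵥ uj) a‖ ^ 2) := by
        rw [h4, Real.sqrt_one, one_mul]
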